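/- Let f be a function holomorphic in an open neighborhood of a polynomially convex compact set K ⊆ ℂ^n. Then f can be uniformly approximated on K by polynomials in n complex variables; that is, for every ε > 0 there is a polynomial p with sup_{z ∈ K} |f(z) − p(z)| < ε. -/

import Mathlib

open Set Filter Topology MvPolynomial

noncomputable section

/-- The complex Euclidean space `ℂ^N`. -/
abbrev CE (N : ℕ) := Fin N → ℂ

/-- The natural projection `ℂ^{a+b} → ℂ^a` (onto the first `a` coordinates). -/
def projFst (a b : ℕ) (z : CE (a + b)) : CE a := fun i => z (Fin.castAdd b i)

/-- The natural projection `ℂ^{a+b} → ℂ^b` (onto the last `b` coordinates). -/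
def projSnd (a b : ℕ) (z : CE (a + b)) : CE b := fun i => z (Fin.natAdd a i)

/-- The cylinder `U × ℂ^b ⊆ ℂ^{a+b}` over `U ⊆ ℂ^a`. -/
def cylOver {a : ℕ} (b : ℕ) (U : Set (CE a)) : Set (CE (a + b)) :=
  {z | projFst a b z ∈ U}

/-- The product `U × B ⊆ ℂ^{a+b}` of `U ⊆ ℂ^a` and `B ⊆ ℂ^b`. -/
def prodSet {a b : ℕ} (U : Set (CE a)) (B : Set (CE b)) : Set (CE (a + b)) :=
  {z | projFst a b z ∈ U ∧ projSnd a b z ∈ B}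

/-- The open ball of radius `r` in `ℂ = ℂ^1`. -/
def ball1 (r : ℝ) : Set (CE 1) := {w | ‖w 0‖ < r}

/-- The open Euclidean ball of radius `t` in `ℂ^l`. -/
def eball (l : ℕ) (t : ℝ) : Set (CE l) := {x | ∑ i, ‖x i‖ ^ 2 < t ^ 2}

/-- An algebraic subset of `ℂ^N`: the common zero set of finitely many polynomials. -/
def IsAlgebraicSet {N : ℕ} (X : Set (CE N)) : Prop :=
  ∃ s : Finset (MvPolynomial (Fin N) ℂ), X = {z | ∀ p ∈ s, eval z p = 0}

/-- An analytic subset `X` of an open set `Ω ⊆ ℂ^N`: locally (at every point of `Ω`)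
the common zero set of finitely many holomorphic functions. -/
def IsAnalyticSet {N : ℕ} (Ω X : Set (CE N)) : Prop :=
  X ⊆ Ω ∧ ∀ z ∈ Ω, ∃ U : Set (CE N), IsOpen U ∧ z ∈ U ∧ U ⊆ Ω ∧
    ∃ s : Finset (CE N → ℂ), (∀ f ∈ s, AnalyticOnNhd ℂ f U) ∧
      X ∩ U = {w ∈ U | ∀ f ∈ s, f w = 0}

/-- `X` is, near `a`, a `d`-dimensional complex submanifold of `ℂ^N`: there is a local
biholomorphism straightening `X` to the linear subspace `{z : z_i = 0 for i ≥ d}`. -/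
def IsSubmanifoldPtOfDim {N : ℕ} (X : Set (CE N)) (d : ℕ) (a : CE N) : Prop :=
  ∃ (V W : Set (CE N)) (φ ψ : CE N → CE N),
    IsOpen V ∧ a ∈ V ∧ IsOpen W ∧
    AnalyticOnNhd ℂ φ V ∧ AnalyticOnNhd ℂ ψ W ∧
    MapsTo φ V W ∧ MapsTo ψ W V ∧
    (∀ x ∈ V, ψ (φ x) = x) ∧ (∀ y ∈ W, φ (ψ y) = y) ∧
    φ '' (X ∩ V) = W ∩ {z | ∀ i : Fin N, d ≤ (i : ℕ) → z i = 0}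

/-- `X` is purely `k`-dimensional: every point of `X` near which `X` is a submanifold is a
point of dimension exactly `k`, and such (regular) points are dense in `X`. -/
def PureDimOf {N : ℕ} (X : Set (CE N)) (k : ℕ) : Prop :=
  (∀ a ∈ X, a ∈ closure {b | b ∈ X ∧ IsSubmanifoldPtOfDim X k b}) ∧
  (∀ b ∈ X, ∀ d, IsSubmanifoldPtOfDim X d b → d = k)

/-- The singular locus of `X`: the points of `X` at which `X` is not locally a submanifold. -/
def singLocus {N : ℕ} (X : Set (CE N)) : Set (CE N) :=
  {a ∈ X | ¬ ∃ d, IsSubmanifoldPtOfDim X d a}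

/-- An irreducible analytic subset of the open set `Ω`. -/
def IsIrreducibleAnalyticSet {N : ℕ} (Ω X : Set (CE N)) : Prop :=
  IsAnalyticSet Ω X ∧ X.Nonempty ∧
  ∀ A B : Set (CE N), IsAnalyticSet Ω A → IsAnalyticSet Ω B → X = A ∪ B → X = A ∨ X = B

/-- `C` is an (analytic) irreducible component of the analytic set `X ⊆ Ω`:
an irreducible analytic subset of `Ω` contained in `X`, maximal among such. -/
def IsIrreducibleComponent {N : ℕ} (Ω X C : Set (CE N)) : Prop :=
  IsIrreducibleAnalyticSet Ω C ∧ C ⊆ X ∧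
  ∀ C' : Set (CE N), IsIrreducibleAnalyticSet Ω C' → C ⊆ C' → C' ⊆ X → C' = C

/-- `A` is the union of some of the analytic irreducible components of `X` in `Ω`. -/
def IsUnionOfComponents {N : ℕ} (Ω X A : Set (CE N)) : Prop :=
  ∃ 𝒞 : Set (Set (CE N)), (∀ C ∈ 𝒞, IsIrreducibleComponent Ω X C) ∧ A = ⋃₀ 𝒞

/-- The germ of the analytic set `Z` at `a` is irreducible. -/
def GermIrreducibleAt {N : ℕ} (Z : Set (CE N)) (a : CE N) : Prop :=
  ∀ U A B : Set (CE N), IsOpen U → a ∈ U → IsAnalyticSet U A → IsAnalyticSet U B →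
    Z ∩ U = A ∪ B →
    (∃ V, IsOpen V ∧ a ∈ V ∧ Z ∩ V = A ∩ V) ∨ (∃ V, IsOpen V ∧ a ∈ V ∧ Z ∩ V = B ∩ V)

/-- A Nash function on the open set `U ⊆ ℂ^N`: a holomorphic function annihilated,
locally around every point of `U`, by a nonzero polynomial `P(x, f(x)) = 0`. -/
def IsNashFn {N : ℕ} (U : Set (CE N)) (f : CE N → ℂ) : Prop :=
  AnalyticOnNhd ℂ f U ∧ ∀ x₀ ∈ U, ∃ V : Set (CE N), IsOpen V ∧ x₀ ∈ V ∧ V ⊆ U ∧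
    ∃ P : MvPolynomial (Fin (N + 1)) ℂ, P ≠ 0 ∧
      ∀ x ∈ V, eval (Fin.snoc x (f x)) P = 0

/-- A Nash subset `Y` of the open set `Ω ⊆ ℂ^N`: locally (at every point of `Ω`) the common
zero set of finitely many Nash functions. -/
def IsNashSet {N : ℕ} (Ω Y : Set (CE N)) : Prop :=
  Y ⊆ Ω ∧ ∀ y ∈ Ω, ∃ U : Set (CE N), IsOpen U ∧ y ∈ U ∧ U ⊆ Ω ∧
    ∃ s : Finset (CE N → ℂ), (∀ f ∈ s, IsNashFn U f) ∧
      Y ∩ U = {x ∈ U | ∀ f ∈ s, f x = 0}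

/-- `U` is a domain of holomorphy in `ℂ^N`. -/
def IsDomainOfHolomorphy {N : ℕ} (U : Set (CE N)) : Prop :=
  IsOpen U ∧ ¬ ∃ U₁ U₂ : Set (CE N), IsOpen U₁ ∧ IsOpen U₂ ∧ U₁.Nonempty ∧
    U₁ ⊆ U ∩ U₂ ∧ IsConnected U₂ ∧ ¬ U₂ ⊆ U ∧
    ∀ f : CE N → ℂ, AnalyticOnNhd ℂ f U →
      ∃ F : CE N → ℂ, AnalyticOnNhd ℂ F U₂ ∧ EqOn f F U₁

/-- A Runge domain in `ℂ^N`: a domain of holomorphy on which every holomorphic function can be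
approximated uniformly on compact subsets by polynomials. -/
def IsRungeDomain {N : ℕ} (U : Set (CE N)) : Prop :=
  IsDomainOfHolomorphy U ∧
  ∀ f : CE N → ℂ, AnalyticOnNhd ℂ f U → ∀ K : Set (CE N), IsCompact K → K ⊆ U →
    ∀ ε : ℝ, 0 < ε → ∃ p : MvPolynomial (Fin N) ℂ, ∀ z ∈ K, ‖f z - eval z p‖ < ε

/-- The projection `ℂ^{a+b} → ℂ^a` restricted to `X` maps `X` into `U` and is proper over `U`. -/
def ProperProjTo {a b : ℕ} (X : Set (CE (a + b))) (U : Set (CE a)) : Prop :=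
  (∀ z ∈ X, projFst a b z ∈ U) ∧
  ∀ K : Set (CE a), IsCompact K → K ⊆ U → IsCompact {z ∈ X | projFst a b z ∈ K}

/-- Local uniform convergence of the closed subsets `Y ν` of `W` to `Y'`. -/
def LocUnifConvSets {N : ℕ} (W : Set (CE N)) (Y : ℕ → Set (CE N)) (Y' : Set (CE N)) : Prop :=
  (∀ a ∈ Y', ∃ u : ℕ → CE N, (∀ ν, u ν ∈ Y ν) ∧ Tendsto u atTop (𝓝 a)) ∧
  ∀ K : Set (CE N), IsCompact K → K ⊆ W → K ∩ Y' = ∅ → ∀ᶠ ν in atTop, K ∩ Y ν = ∅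

/-- `X` and `T` meet transversally at `a`: their tangent spaces at `a` span `ℂ^N`. -/
def TransversalAt {N : ℕ} (X T : Set (CE N)) (a : CE N) : Prop :=
  Submodule.span ℂ (tangentConeAt ℂ X a ∪ tangentConeAt ℂ T a) = ⊤

/-- `T` is a `d`-dimensional complex submanifold of the open set `W`. -/
def IsSubmanifoldOfDim {N : ℕ} (W T : Set (CE N)) (d : ℕ) : Prop :=
  T ⊆ W ∧ ∀ a ∈ T, IsSubmanifoldPtOfDim T d a

/-- Convergence, in the open set `W ⊆ ℂ^N`, of the purely `k`-dimensional analytic sets `Z ν`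
to the purely `k`-dimensional analytic set `Z'` in the sense of holomorphic chains (all
multiplicities being `1`): local uniform convergence of supports, together with the degree
condition: for every regular point `a` of `Z'` and every `(N-k)`-dimensional submanifold `T`
transversal to `Z'` at `a`, with compact closure contained in `W` and meeting `Z'` only at `a`
(so that `deg(Z' · T) = 1`), for almost all `ν` the chain `Z ν · T` also has degree one, i.e.
`Z ν` meets `T` in exactly one point, which is a regular point of `Z ν` where the intersection
is transversal. -/
def ChainsConvTo {N : ℕ} (W : Set (CE N)) (k : ℕ) (Z : ℕ → Set (CE N))
    (Z' : Set (CE N)) : Prop :=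
  LocUnifConvSets W Z Z' ∧
  ∀ (a : CE N) (T : Set (CE N)), a ∈ Z' → IsSubmanifoldPtOfDim Z' k a →
    IsSubmanifoldOfDim W T (N - k) → IsCompact (closure T) → closure T ⊆ W →
    Z' ∩ closure T = {a} → TransversalAt Z' T a →
    ∀ᶠ ν in atTop, ∃ b, Z ν ∩ T = {b} ∧ IsSubmanifoldPtOfDim (Z ν) k b ∧
      TransversalAt (Z ν) T b

/-- A polynomial polyhedron in `ℂ^N`: a set of the form `{z : |q₁ z| ≤ c₁, …, |q_s z| ≤ c_s}`. -/
def IsPolyPolyhedron {N : ℕ} (P : Set (CE N)) : Prop :=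
  ∃ (s : Finset (MvPolynomial (Fin N) ℂ)) (c : MvPolynomial (Fin N) ℂ → ℝ),
    P = {z | ∀ q ∈ s, ‖eval z q‖ ≤ c q}

/-- A compact set `K ⊆ ℂ^N` is polynomially convex: it equals its polynomially convex hull. -/
def PolyConvex {N : ℕ} (K : Set (CE N)) : Prop :=
  K = {z | ∀ p : MvPolynomial (Fin N) ℂ,
    ‖eval z p‖ ≤ sSup ((fun w => ‖eval w p‖) '' K)}

/-- Sign condition used in the definition of semialgebraic sets. -/
def signCond (c : Ordering) (t : ℝ) : Prop :=
  match c with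
  | .lt => t < 0
  | .eq => t = 0
  | .gt => 0 < t

/-- Evaluation of a real polynomial in the `2m` real coordinates of `z ∈ ℂ^m`. -/
def realizeRe {m : ℕ} (p : MvPolynomial (Fin m ⊕ Fin m) ℝ) (z : CE m) : ℝ :=
  MvPolynomial.eval (Sum.elim (fun i => (z i).re) (fun i => (z i).im)) p

/-- A subset of `ℂ^m ≅ ℝ^{2m}` is semialgebraic: a finite union of finite intersections of
sets defined by polynomial sign conditions in the real coordinates. -/
def IsSemialgebraic {m : ℕ} (S : Set (CE m)) : Prop :=
  ∃ (n r : ℕ) (P : Fin n → Fin r → MvPolynomial (Fin m ⊕ Fin m) ℝ)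
    (σ : Fin n → Fin r → Ordering),
    S = ⋃ i, ⋂ j, {z | signCond (σ i j) (realizeRe (P i j) z)}

end


namespace OkaWeilProof

open scoped ContDiff Matrix
open MeasureTheory

/-- The operator `∂/∂z̄_k`. -/
noncomputable def db {n : ℕ} (k : Fin n) (g : CE n → ℂ) (z : CE n) : ℂ :=
  (1 / 2) * (fderiv ℝ g z (Pi.single k 1) + Complex.I * fderiv ℝ g z (Pi.single k Complex.I))

lemma db_congr {n : ℕ} {k : Fin n} {g h : CE n → ℂ} {z : CE n} (e : g =ᶠ[𝓝 z] h) :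
    db k g z = db k h z := by
  unfold db; rw [e.fderiv_eq]

lemma db_mul {n : ℕ} {k : Fin n} {g h : CE n → ℂ} {z : CE n}
    (hg : DifferentiableAt ℝ g z) (hh : DifferentiableAt ℝ h z) :
    db k (fun w => g w * h w) z = g z * db k h z + db k g z * h z := by
  unfold db
  rw [fderiv_fun_mul hg hh]
  simp
  ring

lemma db_sum {n : ℕ} {ι : Type*} (S : Finset ι) {k : Fin n} {g : ι → CE n → ℂ} {z : CE n}
    (hg : ∀ i ∈ S, DifferentiableAt ℝ (g i) z) :
    db k (fun w => ∑ i ∈ S, g i w) z = ∑ i ∈ S, db k (g i) z := by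
  unfold db
  rw [fderiv_fun_sum hg]
  simp [Finset.mul_sum, Finset.sum_add_distrib, mul_add]

lemma db_const {n : ℕ} {k : Fin n} (c : ℂ) {z : CE n} : db k (fun _ => c) z = 0 := by
  unfold db; simp

lemma db_add {n : ℕ} {k : Fin n} {g h : CE n → ℂ} {z : CE n}
    (hg : DifferentiableAt ℝ g z) (hh : DifferentiableAt ℝ h z) :
    db k (fun w => g w + h w) z = db k g z + db k h z := by
  unfold db; rw [fderiv_fun_add hg hh]; simp; ring

lemma db_sub {n : ℕ} {k : Fin n} {g h : CE n → ℂ} {z : CE n}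
    (hg : DifferentiableAt ℝ g z) (hh : DifferentiableAt ℝ h z) :
    db k (fun w => g w - h w) z = db k g z - db k h z := by
  unfold db; rw [fderiv_fun_sub hg hh]; simp; ring

lemma db_const_mul {n : ℕ} {k : Fin n} {g : CE n → ℂ} {z : CE n} (c : ℂ)
    (hg : DifferentiableAt ℝ g z) :
    db k (fun w => c * g w) z = c * db k g z := by
  rw [db_mul (differentiableAt_const c) hg, db_const]; simp

lemma db_holo {n : ℕ} {k : Fin n} {g : CE n → ℂ} {z : CE n}
    (hg : DifferentiableAt ℂ g z) : db k g z = 0 := by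
  unfold db
  rw [hg.fderiv_restrictScalars ℝ]
  have : (Pi.single k Complex.I : CE n) = Complex.I • Pi.single k 1 := by
    ext i; by_cases h : i = k
    · subst h; simp
    · simp [h]
  rw [this]
  simp only [ContinuousLinearMap.coe_restrictScalars', map_smul, smul_eq_mul]
  rw [← mul_assoc, Complex.I_mul_I]; ring

lemma db_contDiff {n : ℕ} {k : Fin n} {g : CE n → ℂ} (hg : ContDiff ℝ ∞ g) :
    ContDiff ℝ ∞ (db k g) := by
  unfold db
  have h1 : ContDiff ℝ ∞ (fderiv ℝ g) := hg.fderiv_right (by simp)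
  have h2 : ∀ v, ContDiff ℝ ∞ (fun z => fderiv ℝ g z v) := fun v => h1.clm_apply contDiff_const
  exact contDiff_const.mul ((h2 _).add (contDiff_const.mul (h2 _)))

lemma db_comm {n : ℕ} {k l : Fin n} {g : CE n → ℂ} (hg : ContDiff ℝ ∞ g) (z : CE n) :
    db k (db l g) z = db l (db k g) z := by
  have h1 : ContDiff ℝ ∞ (fderiv ℝ g) := hg.fderiv_right (by simp)
  have h2 : ∀ v, ContDiff ℝ ∞ (fun z => fderiv ℝ g z v) := fun v => h1.clm_apply contDiff_const
  have hs : IsSymmSndFDerivAt ℝ g z := hg.contDiffAt.isSymmSndFDerivAt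
    (by rw [minSmoothness_of_isRCLikeNormedField]; exact WithTop.coe_le_coe.2 le_top)
  have h3 : ∀ v w, fderiv ℝ (fun z => fderiv ℝ g z v) z w = fderiv ℝ (fderiv ℝ g) z w v := by
    intro v w
    rw [fderiv_clm_apply (h1.differentiable (by simp) z) (differentiableAt_const v)]
    simp
  have h4 : ∀ k l : Fin n, ∀ w, fderiv ℝ (db l g) z w = (1 / 2) *
      (fderiv ℝ (fderiv ℝ g) z w (Pi.single l 1)
        + Complex.I * fderiv ℝ (fderiv ℝ g) z w (Pi.single l Complex.I)) := by
    intro k l w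
    unfold db
    have d : ∀ v, DifferentiableAt ℝ (fun z => fderiv ℝ g z v) z :=
      fun v => (h2 v).differentiable (by simp) z
    rw [fderiv_const_mul ((d _).fun_add ((d _).const_mul _)),
      fderiv_fun_add (d _) ((d _).const_mul _), fderiv_const_mul (d _)]
    simp [h3, mul_add]
  have e : ∀ k l : Fin n, db k (db l g) z = (1 / 2) * (fderiv ℝ (db l g) z (Pi.single k 1)
      + Complex.I * fderiv ℝ (db l g) z (Pi.single k Complex.I)) := fun _ _ => rfl
  rw [e, e, h4 k l, h4 k l, h4 k k, h4 k k]
  rw [hs.eq (Pi.single k 1) (Pi.single l 1), hs.eq (Pi.single k 1) (Pi.single l Complex.I),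
    hs.eq (Pi.single k Complex.I) (Pi.single l 1),
    hs.eq (Pi.single k Complex.I) (Pi.single l Complex.I)]
  ring

lemma integral_db {n : ℕ} {k : Fin n} {F V : CE n → ℂ} (hF : ContDiff ℝ ∞ F)
    (hc : HasCompactSupport F) (hV : ContDiff ℝ ∞ V) :
    ∫ z, F z * db k V z = - ∫ z, db k F z * V z := by
  have dF : ∀ v, Continuous (fun z => fderiv ℝ F z v) := fun v =>
    ((hF.continuous_fderiv (by simp)).clm_apply continuous_const)
  have dV : ∀ v, Continuous (fun z => fderiv ℝ V z v) := fun v =>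
    ((hV.continuous_fderiv (by simp)).clm_apply continuous_const)
  have cF : ∀ v, HasCompactSupport (fun z => fderiv ℝ F z v) := fun v => hc.fderiv_apply ℝ v
  have i1 : ∀ v, Integrable (fun z => fderiv ℝ F z v * V z) := fun v =>
    ((dF v).mul hV.continuous).integrable_of_hasCompactSupport ((cF v).mul_right)
  have i2 : ∀ v, Integrable (fun z => F z * fderiv ℝ V z v) := fun v =>
    (hF.continuous.mul (dV v)).integrable_of_hasCompactSupport (hc.mul_right)
  have i3 : Integrable (fun z => F z * V z) :=
    (hF.continuous.mul hV.continuous).integrable_of_hasCompactSupport (hc.mul_right)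
  have key : ∀ v, ∫ z, F z * fderiv ℝ V z v = - ∫ z, fderiv ℝ F z v * V z := fun v =>
    integral_mul_fderiv_eq_neg_fderiv_mul_of_integrable (i1 v) (i2 v) i3
      (fun x _ => hF.differentiable (by simp) x) (fun x _ => hV.differentiable (by simp) x)
  have e1 : ∀ z, F z * db k V z = (1 / 2) * (F z * fderiv ℝ V z (Pi.single k 1))
      + (1 / 2 * Complex.I) * (F z * fderiv ℝ V z (Pi.single k Complex.I)) := by
    intro z; unfold db; ring
  have e2 : ∀ z, db k F z * V z = (1 / 2) * (fderiv ℝ F z (Pi.single k 1) * V z)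
      + (1 / 2 * Complex.I) * (fderiv ℝ F z (Pi.single k Complex.I) * V z) := by
    intro z; unfold db; ring
  simp only [e1, e2]
  rw [integral_add ((i2 _).const_mul _) ((i2 _).const_mul _),
    integral_add ((i1 _).const_mul _) ((i1 _).const_mul _)]
  simp only [integral_const_mul, key]
  ring

lemma det_updateRow_eq_sum {n : ℕ} (M : Matrix (Fin n) (Fin n) ℂ) (i : Fin n) (v : Fin n → ℂ) :
    (M.updateRow i v).det = ∑ l, v l * (M.updateRow i (Pi.single l 1)).det := by
  have : v = ∑ l, (v l) • (Pi.single l (1:ℂ) : Fin n → ℂ) := by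
    ext l'
    simp [Finset.sum_apply, Pi.single_apply]
  conv_lhs => rw [this]
  rw [← Matrix.cramer_transpose_apply, map_sum, Finset.sum_apply]
  refine Finset.sum_congr rfl fun l _ => ?_
  rw [map_smul, Pi.smul_apply, Matrix.cramer_transpose_apply, smul_eq_mul]

/-- Derivative of a determinant, row by row. -/
lemma hasFDerivAt_det_rows {n : ℕ} {E : Type*} [NormedAddCommGroup E] [NormedSpace ℝ E]
    {M : E → Matrix (Fin n) (Fin n) ℂ} {M' : Fin n → Fin n → E →L[ℝ] ℂ} {x : E}
    (h : ∀ i l, HasFDerivAt (fun z => M z i l) (M' i l) x) :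
    HasFDerivAt (fun z => (M z).det)
      (∑ i, ∑ l, ((M x).updateRow i (Pi.single l 1)).det • M' i l) x := by
  let f0 : MultilinearMap ℝ (fun _ : Fin n => (Fin n → ℂ)) ℂ :=
    (Matrix.detRowAlternating (n := Fin n) (R := ℂ)).toMultilinearMap.restrictScalars ℝ
  have hf0 : ∀ A : Matrix (Fin n) (Fin n) ℂ, f0 A = A.det := fun A => rfl
  let f : ContinuousMultilinearMap ℝ (fun _ : Fin n => (Fin n → ℂ)) ℂ :=
    ⟨f0, by
      change Continuous (fun A : Matrix (Fin n) (Fin n) ℂ => A.det)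
      exact Continuous.matrix_det continuous_id⟩
  have hM : HasFDerivAt (fun z => (fun i => fun l => M z i l))
      (ContinuousLinearMap.pi fun i => ContinuousLinearMap.pi fun l => M' i l) x :=
    hasFDerivAt_pi.2 fun i => hasFDerivAt_pi.2 fun l => h i l
  have := (f.hasFDerivAt (fun i => fun l => M x i l)).comp x hM
  refine this.congr_fderiv ?_
  ext v
  simp only [ContinuousLinearMap.comp_apply, ContinuousMultilinearMap.linearDeriv_apply]
  rw [sum_apply]
  refine Finset.sum_congr rfl fun i _ => ?_
  change ((M x).updateRow i (fun l => M' i l v)).det = _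
  rw [det_updateRow_eq_sum, sum_apply]
  refine Finset.sum_congr rfl fun l _ => ?_
  simp [mul_comm]


/-- The matrix `(∂s_j/∂z̄_k)`. -/
noncomputable def dbM {n : ℕ} (s : Fin n → CE n → ℂ) (z : CE n) : Matrix (Fin n) (Fin n) ℂ :=
  Matrix.of fun j k => db k (s j) z

lemma db_det {n : ℕ} {M : CE n → Matrix (Fin n) (Fin n) ℂ} {k : Fin n} {z : CE n}
    (h : ∀ i l, DifferentiableAt ℝ (fun z => M z i l) z) :
    db k (fun z => (M z).det) z
      = ∑ i, ∑ l, ((M z).updateRow i (Pi.single l 1)).det * db k (fun z => M z i l) z := by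
  have := (hasFDerivAt_det_rows (fun i l => (h i l).hasFDerivAt)).fderiv
  unfold db
  rw [this]
  simp only [sum_apply, smul_apply, smul_eq_mul, Finset.mul_sum, ← Finset.sum_add_distrib]
  refine Finset.sum_congr rfl fun i _ => Finset.sum_congr rfl fun l _ => ?_
  ring

lemma contDiff_det {n : ℕ} {M : CE n → Matrix (Fin n) (Fin n) ℂ}
    (h : ∀ i l, ContDiff ℝ ∞ (fun z => M z i l)) : ContDiff ℝ ∞ (fun z => (M z).det) := by
  simp only [Matrix.det_apply]
  refine ContDiff.sum fun σ _ => ContDiff.const_smul _ ?_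
  exact contDiff_prod fun i _ => h _ _

lemma contDiff_adj {n : ℕ} {M : CE n → Matrix (Fin n) (Fin n) ℂ}
    (h : ∀ i l, ContDiff ℝ ∞ (fun z => M z i l)) (k j : Fin n) :
    ContDiff ℝ ∞ (fun z => (M z).adjugate k j) := by
  simp only [Matrix.adjugate_apply]
  refine contDiff_det fun i l => ?_
  by_cases hi : i = j
  · subst hi; simp only [Matrix.updateRow_self]; exact contDiff_const
  · simp only [Matrix.updateRow_ne hi]; exact h i l

/-- Piola identity. -/
lemma piola {n : ℕ} {s : Fin n → CE n → ℂ} (hs : ∀ j, ContDiff ℝ ∞ (s j)) (j : Fin n) (z : CE n) :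
    ∑ k, db k (fun w => (dbM s w).adjugate k j) z = 0 := by
  have hM : ∀ i l, ContDiff ℝ ∞ (fun z => dbM s z i l) := fun i l => db_contDiff (hs i)
  have step : ∀ k, db k (fun w => (dbM s w).adjugate k j) z
      = ∑ i, if i = j then 0 else ∑ l, ((((dbM s z).updateRow j (Pi.single k 1))).updateRow i
          (Pi.single l 1)).det * db k (db l (s i)) z := by
    intro k
    simp only [Matrix.adjugate_apply]
    rw [db_det]
    · refine Finset.sum_congr rfl fun i _ => ?_
      by_cases hi : i = j
      · subst hi
        simp [Matrix.updateRow_self, db_const]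
      · simp only [Matrix.updateRow_ne hi, hi, if_false]
        rfl
    · intro i l
      by_cases hi : i = j
      · subst hi; simp only [Matrix.updateRow_self]; exact differentiableAt_const _
      · simp only [Matrix.updateRow_ne hi]; exact (hM i l).differentiable (by simp) z
  simp only [step]
  rw [Finset.sum_comm]
  refine Finset.sum_eq_zero fun i _ => ?_
  by_cases hi : i = j
  · simp [hi]
  simp only [hi, if_false]
  set T : Fin n → Fin n → ℂ := fun k l => ((((dbM s z).updateRow j (Pi.single k 1))).updateRow i
          (Pi.single l 1)).det with hT
  have anti : ∀ k l, T k l = - T l k := by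
    intro k l
    have := Matrix.det_permute (Equiv.swap i j) (((dbM s z).updateRow j (Pi.single l 1)).updateRow i
          (Pi.single k 1))
    rw [Equiv.Perm.sign_swap hi] at this
    simp only [hT]
    have e : ((((dbM s z).updateRow j (Pi.single l 1)).updateRow i
          (Pi.single k 1)).submatrix (Equiv.swap i j) id)
        = (((dbM s z).updateRow j (Pi.single k 1))).updateRow i (Pi.single l 1) := by
      ext a b
      simp only [Matrix.submatrix_apply, id]
      by_cases ha : a = i
      · subst ha
        rw [Equiv.swap_apply_left, Matrix.updateRow_self, Matrix.updateRow_ne (Ne.symm hi),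
          Matrix.updateRow_self]
      · by_cases hb : a = j
        · subst hb
          rw [Equiv.swap_apply_right, Matrix.updateRow_self, Matrix.updateRow_ne ha,
            Matrix.updateRow_self]
        · rw [Equiv.swap_apply_of_ne_of_ne ha hb, Matrix.updateRow_ne ha, Matrix.updateRow_ne hb,
            Matrix.updateRow_ne ha, Matrix.updateRow_ne hb]
    rw [e] at this
    rw [this]; simp
  have h2 : ∑ k, ∑ l, T k l * db k (db l (s i)) z = - ∑ k, ∑ l, T k l * db k (db l (s i)) z := by
    conv_lhs => rw [Finset.sum_comm]
    rw [← Finset.sum_neg_distrib]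
    refine Finset.sum_congr rfl fun k _ => ?_
    rw [← Finset.sum_neg_distrib]
    refine Finset.sum_congr rfl fun l _ => ?_
    rw [anti l k, db_comm (hs i)]; ring
  exact self_eq_neg.1 h2

lemma adj_mulVec_eq_zero {n : ℕ} {J : Matrix (Fin n) (Fin n) ℂ} {w s σ : Fin n → ℂ}
    (h1 : w ⬝ᵥ s = 1) (h2 : w ⬝ᵥ σ = 0) (h3 : w ᵥ* J = 0) : J.adjugate *ᵥ σ = 0 := by
  set E : Matrix (Fin n) (Fin n) ℂ := 1 - Matrix.vecMulVec s w with hE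
  have hEJ : E * J = J := by
    rw [hE, Matrix.sub_mul, Matrix.one_mul, Matrix.vecMulVec_mul, h3]
    simp
  have hw : w ≠ 0 := by rintro rfl; simp at h1
  have hdet : E.det = 0 := by
    rw [← Matrix.exists_vecMul_eq_zero_iff]
    refine ⟨w, hw, ?_⟩
    rw [hE, Matrix.vecMul_sub, Matrix.vecMul_one, Matrix.vecMul_vecMulVec, h1]
    simp
  have hEσ : E *ᵥ σ = σ := by
    rw [hE, Matrix.sub_mulVec, Matrix.one_mulVec, Matrix.vecMulVec_mulVec, h2]
    simp
  rw [← hEJ, Matrix.adjugate_mul_distrib, ← Matrix.mulVec_mulVec]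
  conv_lhs => rw [← hEσ]
  rw [Matrix.mulVec_mulVec (M := E.adjugate), Matrix.adjugate_mul, hdet]
  simp

/-- The derivative of the homotopy is a divergence, so its integral vanishes. -/
lemma integral_div_eq_zero {n : ℕ} {F : CE n → ℂ} {s σ : Fin n → CE n → ℂ} {W : Set (CE n)}
    {x : CE n} (hF : ContDiff ℝ ∞ F) (hc : HasCompactSupport F) (hs : ∀ j, ContDiff ℝ ∞ (s j))
    (hσ : ∀ j, ContDiff ℝ ∞ (σ j)) (hW : IsOpen W) (hFW : ∀ z ∉ W, ∀ k, db k F z = 0)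
    (hsW : ∀ z ∈ W, ∑ j, (z j - x j) * s j z = 1) (hσW : ∀ z ∈ W, ∑ j, (z j - x j) * σ j z = 0) :
    ∫ z, F z * ∑ j, ∑ k, (dbM s z).adjugate k j * db k (σ j) z = 0 := by
  have hM : ∀ i l, ContDiff ℝ ∞ (fun z => dbM s z i l) := fun i l => db_contDiff (hs i)
  set V : Fin n → CE n → ℂ := fun k z => ∑ j, (dbM s z).adjugate k j * σ j z with hV
  have hVc : ∀ k, ContDiff ℝ ∞ (V k) := fun k =>
    ContDiff.sum fun j _ => (contDiff_adj hM k j).mul (hσ j)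
  have hdiv : ∀ z, ∑ k, db k (V k) z = ∑ j, ∑ k, (dbM s z).adjugate k j * db k (σ j) z := by
    intro z
    have : ∀ k, db k (V k) z = ∑ j, ((dbM s z).adjugate k j * db k (σ j) z
        + db k (fun w => (dbM s w).adjugate k j) z * σ j z) := by
      intro k
      have d1 : ∀ j, DifferentiableAt ℝ (fun z => (dbM s z).adjugate k j) z :=
        fun j => (contDiff_adj hM k j).differentiable (by simp) z
      have d2 : ∀ j, DifferentiableAt ℝ (σ j) z := fun j => (hσ j).differentiable (by simp) z
      rw [hV, db_sum _ (fun j _ => (d1 j).fun_mul (d2 j))]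
      exact Finset.sum_congr rfl fun j _ => db_mul (d1 j) (d2 j)
    simp only [this]
    rw [Finset.sum_comm]
    refine Finset.sum_congr rfl fun j _ => ?_
    rw [Finset.sum_add_distrib, ← Finset.sum_mul, piola hs j z]
    simp
  have hVW : ∀ z ∈ W, ∀ k, V k z = 0 := by
    intro z hz k
    have := adj_mulVec_eq_zero (J := dbM s z) (w := fun j => z j - x j) (s := fun j => s j z)
      (σ := fun j => σ j z) (hsW z hz) (hσW z hz) ?_
    · exact congrFun this k
    · ext l
      have h1 : db l (fun z => ∑ j, (z j - x j) * s j z) z = 0 := by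
        rw [db_congr (h := fun _ => 1) (by filter_upwards [hW.mem_nhds hz] with y hy using hsW y hy),
          db_const]
      have dc : ∀ j, DifferentiableAt ℂ (fun z : CE n => z j - x j) z := fun j => by fun_prop
      have d2 : ∀ j, DifferentiableAt ℝ (s j) z := fun j => (hs j).differentiable (by simp) z
      rw [db_sum _ (fun j _ => ((dc j).restrictScalars ℝ).fun_mul (d2 j))] at h1
      simp only [db_mul ((dc _).restrictScalars ℝ) (d2 _), db_holo (dc _), zero_mul, add_zero] at h1
      simpa [Matrix.vecMul, dotProduct, dbM] using h1
  simp only [← hdiv, Finset.mul_sum]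
  rw [integral_finsetSum]
  · refine Finset.sum_eq_zero fun k _ => ?_
    rw [integral_db hF hc (hVc k)]
    have : ∀ z, db k F z * V k z = 0 := by
      intro z
      by_cases hz : z ∈ W
      · rw [hVW z hz]; simp
      · rw [hFW z hz]; simp
    simp [this]
  · intro k _
    exact (hF.continuous.mul (db_contDiff (hVc k)).continuous).integrable_of_hasCompactSupport
      hc.mul_right

lemma swap_integral {n : ℕ} {g : ℝ → CE n → ℂ} (hg : Continuous (Function.uncurry g))
    {S : Set (CE n)} (hS : IsCompact S) (h0 : ∀ t, ∀ z ∉ S, g t z = 0) (a b : ℝ) :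
    ∫ t in a..b, ∫ z, g t z = ∫ z, (∫ t in a..b, g t z) := by
  apply intervalIntegral_integral_swap
  have e : ((volume : Measure ℝ).restrict (Set.uIoc a b)).prod (volume : Measure (CE n))
      = (volume.prod volume).restrict (Set.uIoc a b ×ˢ Set.univ) := by
    rw [← Measure.prod_restrict, Measure.restrict_univ]
  rw [e]
  change IntegrableOn _ _ _
  have h1 : IntegrableOn (Function.uncurry g) (Set.uIcc a b ×ˢ S) (volume.prod volume) :=
    hg.continuousOn.integrableOn_compact (isCompact_uIcc.prod hS)
  refine h1.of_forall_sdiff_eq_zero (measurableSet_uIoc.prod MeasurableSet.univ) ?_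
  rintro ⟨t, z⟩ ⟨⟨ht, -⟩, h⟩
  apply h0
  intro hz
  exact h ⟨Set.uIoc_subset_uIcc ht, hz⟩

/-- The integral `∫ F det(∂̄ s)` does not depend on `s`. -/
lemma integral_det_eq {n : ℕ} {F : CE n → ℂ} {s s' : Fin n → CE n → ℂ} {W : Set (CE n)}
    {x : CE n} (hF : ContDiff ℝ ∞ F) (hc : HasCompactSupport F) (hs : ∀ j, ContDiff ℝ ∞ (s j))
    (hs' : ∀ j, ContDiff ℝ ∞ (s' j)) (hW : IsOpen W) (hFW : ∀ z ∉ W, ∀ k, db k F z = 0)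
    (hsW : ∀ z ∈ W, ∑ j, (z j - x j) * s j z = 1)
    (hsW' : ∀ z ∈ W, ∑ j, (z j - x j) * s' j z = 1) :
    ∫ z, F z * (dbM s z).det = ∫ z, F z * (dbM s' z).det := by
  set σ : Fin n → CE n → ℂ := fun j z => s' j z - s j z with hσdef
  have hσ : ∀ j, ContDiff ℝ ∞ (σ j) := fun j => (hs' j).sub (hs j)
  set S : ℝ → Fin n → CE n → ℂ := fun t j z => s j z + (t : ℂ) * σ j z with hSdef
  have hS : ∀ t j, ContDiff ℝ ∞ (S t j) := fun t j => (hs j).add (contDiff_const.mul (hσ j))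
  have hSM : ∀ t z, dbM (S t) z = fun j k => db k (s j) z + (t : ℂ) * db k (σ j) z := by
    intro t z
    ext j k
    have d1 : DifferentiableAt ℝ (s j) z := (hs j).differentiable (by simp) z
    have d2 : DifferentiableAt ℝ (σ j) z := (hσ j).differentiable (by simp) z
    change db k (fun z => s j z + (t : ℂ) * σ j z) z = _
    rw [db_add d1 (d2.const_mul _), db_const_mul _ d2]
  set D : ℝ → CE n → ℂ := fun t z => ∑ j, ∑ k, (dbM (S t) z).adjugate k j * db k (σ j) z with hD
  have hcM : ∀ i l, Continuous (fun p : ℝ × CE n => dbM (S p.1) p.2 i l) := by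
    intro i l
    simp only [hSM]
    have c1 : Continuous (db l (s i)) := (db_contDiff (hs i)).continuous
    have c2 : Continuous (db l (σ i)) := (db_contDiff (hσ i)).continuous
    fun_prop
  have hcM' : Continuous (fun p : ℝ × CE n => dbM (S p.1) p.2) :=
    continuous_pi fun i => continuous_pi fun l => hcM i l
  have hDc : Continuous (Function.uncurry D) := by
    refine continuous_finsetSum _ fun j _ => continuous_finsetSum _ fun k _ => ?_
    refine Continuous.mul ?_ ((db_contDiff (hσ j)).continuous.comp continuous_snd)
    exact (hcM'.matrix_adjugate).matrix_elem k j
  have hderiv : ∀ z t, HasDerivAt (fun t => (dbM (S t) z).det) (D t z) t := by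
    intro z t
    have := hasFDerivAt_det_rows (M := fun t => dbM (S t) z) (x := t)
      (M' := fun j k => ContinuousLinearMap.toSpanSingleton ℝ (db k (σ j) z)) ?_
    · have h2 := this.hasDerivAt
      convert h2 using 1
      simp only [hD, sum_apply, Matrix.adjugate_apply]
      refine Finset.sum_congr rfl fun j _ => Finset.sum_congr rfl fun k _ => ?_
      simp
    · intro j k
      simp only [hSM]
      have h3 : HasDerivAt (fun t : ℝ => db k (s j) z + (t : ℂ) * db k (σ j) z)
          (db k (σ j) z) t := by
        have := ((Complex.ofRealCLM.hasDerivAt (x := t)).mul_const (db k (σ j) z)).const_add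
          (db k (s j) z)
        simpa using this
      exact h3.hasFDerivAt
  have hint : ∀ z, ∫ t in (0:ℝ)..1, F z * D t z = F z * (dbM s' z).det - F z * (dbM s z).det := by
    intro z
    have h01 : S 0 = s := by ext j z; simp [hSdef]
    have h11 : S 1 = s' := by ext j z; simp [hSdef, hσdef]
    rw [intervalIntegral.integral_const_mul, intervalIntegral.integral_eq_sub_of_hasDerivAt
      (fun t _ => hderiv z t), h01, h11, mul_sub]
    apply Continuous.intervalIntegrable
    exact Continuous.uncurry_right z hDc
  have hz : ∀ t, ∫ z, F z * D t z = 0 := by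
    intro t
    refine integral_div_eq_zero hF hc (hS t) hσ hW hFW (x := x) ?_ ?_
    · intro z hz
      have : ∀ j, (z j - x j) * S t j z = (1 - (t:ℂ)) * ((z j - x j) * s j z)
          + t * ((z j - x j) * s' j z) := by
        intro j; simp only [hSdef, hσdef]; ring
      simp only [this, Finset.sum_add_distrib, ← Finset.mul_sum, hsW z hz, hsW' z hz]
      ring
    · intro z hz
      simp only [hσdef, mul_sub, Finset.sum_sub_distrib, hsW z hz, hsW' z hz, sub_self]
  have hsw := swap_integral (g := fun t z => F z * D t z)
    ((hF.continuous.comp continuous_snd).mul hDc) hc.isCompact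
    (fun t z hz => by rw [image_eq_zero_of_notMem_tsupport hz, zero_mul]) 0 1
  simp only [hz, hint] at hsw
  have hs0 : ∀ r : Fin n → CE n → ℂ, (∀ j, ContDiff ℝ ∞ (r j)) →
      Integrable (fun z => F z * (dbM r z).det) := by
    intro r hr
    have := contDiff_det (M := dbM r) (fun i l => db_contDiff (hr i))
    exact (hF.continuous.mul this.continuous).integrable_of_hasCompactSupport hc.mul_right
  rw [integral_sub (hs0 _ hs') (hs0 _ hs)] at hsw
  simp at hsw
  exact (sub_eq_zero.1 hsw.symm).symm

lemma exists_eta {δ : ℝ} (hδ : 0 < δ) : ∃ η : ℝ → ℝ, ContDiff ℝ ∞ η ∧ (∀ t, δ ≤ t → t * η t = 1) ∧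
    (∀ t, 0 ≤ η t) ∧ (∀ t, 0 ≤ η t + t * deriv η t) ∧ (∀ t, δ ≤ t → η t + t * deriv η t = 0) ∧
    ∃ t0, 0 < t0 ∧ 0 < η t0 ∧ 0 < η t0 + t0 * deriv η t0 := by
  set a := δ / 2 with ha
  have ha0 : 0 < a := by positivity
  set m : ℝ → ℝ := fun t => Real.smoothTransition (t / a - 1) with hm
  have hmc : ContDiff ℝ ∞ m :=
    Real.smoothTransition.contDiff.comp ((contDiff_id.div_const a).sub contDiff_const)
  have m0 : ∀ t, t ≤ a → m t = 0 := fun t ht => Real.smoothTransition.zero_of_nonpos (by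
    rw [sub_nonpos, div_le_one ha0]; exact ht)
  have m1 : ∀ t, δ ≤ t → m t = 1 := fun t ht => Real.smoothTransition.one_of_one_le (by
    rw [le_sub_iff_add_le, le_div_iff₀ ha0]; linarith)
  have mmono : Monotone m := fun s t h => Real.smoothTransition.monotone (by gcongr)
  have hc : ContDiff ℝ ∞ (fun t => m t / t) := by
    rw [contDiff_iff_contDiffAt]
    intro t
    by_cases ht : t = 0
    · have : (fun t => m t / t) =ᶠ[𝓝 t] fun _ => 0 := by
        filter_upwards [Iio_mem_nhds (show t < a by rw [ht]; exact ha0)] with u hu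
        rw [m0 u (le_of_lt hu), zero_div]
      exact contDiffAt_const.congr_of_eventuallyEq this
    · exact hmc.contDiffAt.div contDiffAt_id ht
  have hd : ∀ t, m t / t + t * deriv (fun t => m t / t) t = deriv m t := by
    intro t
    have e : m = fun t => t * (m t / t) := by
      ext t
      by_cases ht : t = 0
      · rw [ht, m0 0 ha0.le]; simp
      · field_simp
    conv_rhs => rw [e]
    rw [deriv_fun_mul differentiableAt_fun_id (hc.differentiable (by simp) t)]
    simp
  refine ⟨fun t => m t / t, hc, ?_, ?_, ?_, ?_, ?_⟩
  · intro t ht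
    have : t ≠ 0 := by linarith
    simp only [m1 t ht]; field_simp
  · intro t
    rcases le_or_gt t a with h | h
    · simp [m0 t h]
    · exact div_nonneg (Real.smoothTransition.nonneg _) (by linarith)
  · intro t; rw [hd]; exact mmono.deriv_nonneg
  · intro t ht
    rw [hd]
    rcases ht.eq_or_lt with h | h
    · have : IsLocalMax m t := by
        filter_upwards with u
        rw [m1 t ht]; exact Real.smoothTransition.le_one _
      exact this.deriv_eq_zero
    · have : m =ᶠ[𝓝 t] fun _ => 1 := by
        filter_upwards [Ioi_mem_nhds h] with u hu using m1 u (le_of_lt hu)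
      rw [this.deriv_eq]; simp
  · obtain ⟨c, hc1, hc2⟩ := exists_deriv_eq_slope m (show a < δ by rw [ha]; linarith)
      hmc.continuous.continuousOn (hmc.differentiable (by simp)).differentiableOn
    refine ⟨c, ha0.trans hc1.1, ?_, ?_⟩
    · refine div_pos (Real.smoothTransition.pos_of_pos ?_) (ha0.trans hc1.1)
      rw [sub_pos, one_lt_div ha0]; exact hc1.1
    · rw [hd, hc2, m1 δ le_rfl, m0 a le_rfl]
      apply div_pos (by norm_num); linarith [hc1.1, hc1.2]

/-- squared Euclidean norm -/
noncomputable def nsq {n : ℕ} (w : CE n) : ℝ := ∑ j, ‖w j‖ ^ 2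

lemma nsq_contDiff {n : ℕ} : ContDiff ℝ ∞ (nsq (n := n)) := by
  unfold nsq
  exact ContDiff.sum fun j _ => (contDiff_apply ℝ ℂ j).norm_sq ℝ

lemma le_nsq {n : ℕ} (w : CE n) (j : Fin n) : ‖w j‖ ^ 2 ≤ nsq w :=
  Finset.single_le_sum (f := fun j => ‖w j‖ ^ 2) (fun _ _ => by positivity) (Finset.mem_univ j)

lemma hasFDerivAt_nsq {n : ℕ} (x z : CE n) : HasFDerivAt (fun z => nsq (z - x))
    (∑ j, (2 : ℝ) • (innerSL ℝ (z j - x j)).comp (ContinuousLinearMap.proj (R := ℝ) j)) z := by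
  unfold nsq
  refine HasFDerivAt.fun_sum fun j _ => ?_
  have h : HasFDerivAt (fun z : CE n => z j - x j) (ContinuousLinearMap.proj (R := ℝ) j) z :=
    (hasFDerivAt_apply j z).sub_const (x j)
  refine h.norm_sq.congr_fderiv ?_
  ext v; simp

lemma db_conj {n : ℕ} (x z : CE n) (j k : Fin n) :
    db k (fun z => (starRingEnd ℂ) (z j - x j)) z = if j = k then 1 else 0 := by
  have h : HasFDerivAt (fun z : CE n => (starRingEnd ℂ) (z j - x j))
      ((Complex.conjCLE : ℂ →L[ℝ] ℂ).comp (ContinuousLinearMap.proj (R := ℝ) j)) z := by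
    have h1 : HasFDerivAt (fun z : CE n => z j - x j) (ContinuousLinearMap.proj (R := ℝ) j) z :=
      (hasFDerivAt_apply j z).sub_const (x j)
    exact (Complex.conjCLE : ℂ →L[ℝ] ℂ).hasFDerivAt.comp z h1
  unfold db
  rw [h.fderiv]
  by_cases hjk : j = k
  · subst hjk; simp; norm_num
  · simp [hjk]

lemma db_eta {n : ℕ} {η : ℝ → ℝ} (hη : ContDiff ℝ ∞ η) (x z : CE n) (k : Fin n) :
    db k (fun z => ((η (nsq (z - x)) : ℝ) : ℂ)) z
      = ((deriv η (nsq (z - x)) : ℝ) : ℂ) * (z k - x k) := by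
  have h1 := (((hη.differentiable (by simp) (nsq (z - x))).hasDerivAt.comp_hasFDerivAt z
    (hasFDerivAt_nsq x z)))
  have h2 := (Complex.ofRealCLM.hasFDerivAt).comp z h1
  unfold db
  have h3 : fderiv ℝ (fun z => ((η (nsq (z - x)) : ℝ) : ℂ)) z = _ := h2.fderiv
  rw [h3]
  simp only [ContinuousLinearMap.comp_apply, smul_apply, sum_apply, innerSL_apply_apply,
    ContinuousLinearMap.proj_apply, Complex.ofRealCLM_apply, smul_eq_mul, Complex.inner]
  have e : ∀ c : ℂ, ∑ j, 2 * ((Pi.single k c : CE n) j * (starRingEnd ℂ) (z j - x j)).re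
      = 2 * (c * (starRingEnd ℂ) (z k - x k)).re := by
    intro c
    rw [Finset.sum_eq_single k]
    · simp
    · intro j _ hj; simp [hj]
    · simp
  rw [e, e]
  apply Complex.ext <;> simp <;> ring

/-- The radial kernel. -/
noncomputable def srad {n : ℕ} (η : ℝ → ℝ) (x : CE n) (j : Fin n) (z : CE n) : ℂ :=
  (starRingEnd ℂ) (z j - x j) * ((η (nsq (z - x)) : ℝ) : ℂ)

lemma srad_contDiff {n : ℕ} {η : ℝ → ℝ} (hη : ContDiff ℝ ∞ η) (x : CE n) (j : Fin n) :
    ContDiff ℝ ∞ (srad η x j) := by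
  unfold srad
  have h1 : ContDiff ℝ ∞ (fun z : CE n => z j - x j) := (contDiff_apply ℝ ℂ j).sub contDiff_const
  have h2 : ContDiff ℝ ∞ (fun z : CE n => nsq (z - x)) :=
    nsq_contDiff.comp (contDiff_id.sub contDiff_const)
  exact ((Complex.conjCLE : ℂ →L[ℝ] ℂ).contDiff.comp h1).mul
    (Complex.ofRealCLM.contDiff.comp (hη.comp h2))

lemma sum_mul_conj {n : ℕ} (w : CE n) : ∑ j, w j * (starRingEnd ℂ) (w j) = ((nsq w : ℝ) : ℂ) := by
  unfold nsq
  push_cast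
  exact Finset.sum_congr rfl fun j _ => Complex.mul_conj' _

lemma srad_sum {n : ℕ} (η : ℝ → ℝ) (x z : CE n) :
    ∑ j, (z j - x j) * srad η x j z = ((nsq (z - x) * η (nsq (z - x)) : ℝ) : ℂ) := by
  unfold srad
  simp only [← mul_assoc, ← Finset.sum_mul]
  rw [Complex.ofReal_mul, ← sum_mul_conj]
  rfl

/-- The radial density. -/
noncomputable def rho (n : ℕ) (η : ℝ → ℝ) (w : CE n) : ℝ :=
  η (nsq w) ^ (n - 1) * (η (nsq w) + nsq w * deriv η (nsq w))

lemma srad_det {n : ℕ} (hn : n ≠ 0) {η : ℝ → ℝ} (hη : ContDiff ℝ ∞ η) (x z : CE n) :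
    (dbM (srad η x) z).det = ((rho n η (z - x) : ℝ) : ℂ) := by
  set h : ℂ := ((η (nsq (z - x)) : ℝ) : ℂ) with hh
  set h' : ℂ := ((deriv η (nsq (z - x)) : ℝ) : ℂ) with hh'
  have hM : dbM (srad η x) z = h • (1 : Matrix (Fin n) (Fin n) ℂ)
      + Matrix.replicateCol Unit (fun j => (starRingEnd ℂ) (z j - x j) * h')
        * Matrix.replicateRow Unit (fun k => z k - x k) := by
    ext j k
    have d1 : DifferentiableAt ℝ (fun z : CE n => (starRingEnd ℂ) (z j - x j)) z := by
      have h1 : ContDiff ℝ ∞ (fun z : CE n => z j - x j) :=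
        (contDiff_apply ℝ ℂ j).sub contDiff_const
      exact ((Complex.conjCLE : ℂ →L[ℝ] ℂ).contDiff.comp h1).differentiable
        (n := ∞) (by simp) z
    have d2 : DifferentiableAt ℝ (fun z : CE n => ((η (nsq (z - x)) : ℝ) : ℂ)) z := by
      have h2 : ContDiff ℝ ∞ (fun z : CE n => nsq (z - x)) :=
        nsq_contDiff.comp (contDiff_id.sub contDiff_const)
      exact (Complex.ofRealCLM.contDiff.comp (hη.comp h2)).differentiable (n := ∞) (by simp) z
    change db k (fun z => (starRingEnd ℂ) (z j - x j) * ((η (nsq (z - x)) : ℝ) : ℂ)) z = _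
    rw [db_mul d1 d2, db_conj, db_eta hη]
    simp only [Matrix.add_apply, Matrix.smul_apply, Matrix.one_apply, Matrix.mul_apply,
      Matrix.replicateCol_apply, Matrix.replicateRow_apply, Finset.univ_unique,
      Finset.sum_singleton, smul_eq_mul, ← hh, ← hh']
    ring
  have hdet : ∀ (c : ℂ) (u v : Fin n → ℂ), (c • (1 : Matrix (Fin n) (Fin n) ℂ)
      + Matrix.replicateCol Unit u * Matrix.replicateRow Unit v).det
        = c ^ (n - 1) * (c + ∑ j, v j * u j) := by
    intro c u v
    have hsum : ∑ j, v j * u j = v ⬝ᵥ u := rfl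
    rw [hsum]
    obtain ⟨m, rfl⟩ := Nat.exists_eq_succ_of_ne_zero hn
    by_cases hc : c = 0
    · subst hc
      rw [zero_smul, zero_add, zero_add, ← Matrix.vecMulVec_eq]
      rcases m with _ | m
      · simp [Matrix.det_unique, Matrix.vecMulVec_apply, mul_comm, dotProduct]
      · rw [Matrix.det_vecMulVec]; simp
    · have : c • (1 : Matrix (Fin (m + 1)) (Fin (m + 1)) ℂ)
          + Matrix.replicateCol Unit u * Matrix.replicateRow Unit v
          = c • (1 + Matrix.replicateCol Unit (c⁻¹ • u) * Matrix.replicateRow Unit v) := by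
        rw [smul_add, Matrix.replicateCol_smul, Matrix.smul_mul, smul_smul, mul_inv_cancel₀ hc,
          one_smul]
      rw [this, Matrix.det_smul,
        Matrix.det_one_add_replicateCol_mul_replicateRow, dotProduct_smul]
      simp only [Fintype.card_fin, Nat.add_sub_cancel, smul_eq_mul, Nat.succ_eq_add_one]
      rw [pow_succ]
      field_simp
  rw [hM, hdet]
  have : ∑ j, (z j - x j) * ((starRingEnd ℂ) (z j - x j) * h') = ((nsq (z - x) : ℝ) : ℂ) * h' := by
    rw [← sum_mul_conj, Finset.sum_mul]
    refine Finset.sum_congr rfl fun j _ => ?_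
    simp only [Pi.sub_apply]; ring
  rw [this]
  unfold rho
  push_cast
  rfl

/-- Mean value property against a circled density. -/
lemma integral_mean {n : ℕ} {F ρ : CE n → ℂ} {x : CE n} {r r' : ℝ} (hrr : r < r')
    (hF : Continuous F) (hFd : ∀ z ∈ Metric.ball x r', DifferentiableAt ℂ F z)
    (hρ : Continuous ρ) (hρ0 : ∀ w, r < ‖w‖ → ρ w = 0)
    (hrot : ∀ c : ℂ, ‖c‖ = 1 → ∀ w, ρ (c • w) = ρ w) :
    ∫ z, F z * ρ (z - x) = F x * ∫ w, ρ w := by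
  have h1 : ∫ z, F z * ρ (z - x) = ∫ w, F (x + w) * ρ w := by
    rw [← integral_add_left_eq_self (fun z => F z * ρ (z - x)) x]
    simp
  have mp : ∀ c : ℂ, ‖c‖ = 1 → MeasurePreserving (fun w : CE n => c • w) volume volume := by
    intro c hc
    have := (rotation (⟨c, by simpa [Submonoid.unitSphere] using hc⟩ : Circle)).measurePreserving
    exact volume_preserving_pi (fun _ : Fin n => this)
  have h2 : ∀ c : ℂ, ‖c‖ = 1 → ∫ w, F (x + w) * ρ w = ∫ w, F (x + c • w) * ρ w := by
    intro c hc
    have hc0 : c ≠ 0 := by rintro rfl; simp at hc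
    have := (mp c hc).integral_comp ((Homeomorph.smulOfNeZero c hc0).measurableEmbedding)
      (fun w => F (x + w) * ρ w)
    rw [← this]
    simp only [hrot c hc]
  have hsw := swap_integral (g := fun t w => F (x + circleMap 0 1 t • w) * ρ w) (S := Metric.closedBall 0 r)
    (by
      have := continuous_circleMap 0 1
      unfold Function.uncurry
      fun_prop) (isCompact_closedBall 0 r)
    (fun t w hw => by
      rw [hρ0 w (by simpa using hw), mul_zero]) 0 (2 * Real.pi)
  have h3 : ∀ t, ∫ w, F (x + circleMap 0 1 t • w) * ρ w = ∫ w, F (x + w) * ρ w :=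
    fun t => (h2 _ (by simp)).symm
  have h4 : ∀ w, ∫ t in (0:ℝ)..(2 * Real.pi), F (x + circleMap 0 1 t • w) * ρ w
      = (2 * Real.pi : ℝ) • (F x * ρ w) := by
    intro w
    by_cases hw : r < ‖w‖
    · simp [hρ0 w hw]
    have hm : Real.circleAverage (fun c : ℂ => F (x + c • w)) 0 1 = F x := by
      have hd : DifferentiableOn ℂ (fun c : ℂ => F (x + c • w)) (Metric.closedBall 0 1) := by
        intro c hc
        apply DifferentiableAt.differentiableWithinAt
        have : DifferentiableAt ℂ F (x + c • w) := by
          apply hFd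
          rw [Metric.mem_ball, dist_eq_norm, add_sub_cancel_left, norm_smul]
          have : ‖c‖ ≤ 1 := by simpa using hc
          nlinarith [norm_nonneg w]
        exact DifferentiableAt.comp c this (by fun_prop)
      have hdd : DiffContOnCl ℂ (fun c : ℂ => F (x + c • w)) (Metric.ball 0 |1|) := by
        rw [abs_one]
        exact (hd.mono Metric.closure_ball_subset_closedBall).diffContOnCl
      simpa using hdd.circleAverage
    rw [intervalIntegral.integral_mul_const]
    rw [Real.circleAverage_def] at hm
    rw [← hm]
    simp
    field_simp
  simp only [h3, h4] at hsw
  rw [intervalIntegral.integral_const, integral_smul, integral_const_mul, sub_zero] at hsw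
  rw [h1]
  exact smul_right_injective ℂ (by positivity : (2 * Real.pi : ℝ) ≠ 0) hsw

/-- Hefer decomposition for polynomials. -/
lemma hefer {n : ℕ} (P : MvPolynomial (Fin n) ℂ) :
    ∃ Q : Fin n → MvPolynomial (Fin n ⊕ Fin n) ℂ, ∀ z x : CE n,
      ∑ j, (z j - x j) * eval (Sum.elim z x) (Q j) = eval z P - eval x P := by
  induction P using MvPolynomial.induction_on with
  | C a => exact ⟨fun _ => 0, fun z x => by simp⟩
  | add p q hp hq =>
    obtain ⟨Q1, h1⟩ := hp
    obtain ⟨Q2, h2⟩ := hq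
    refine ⟨fun j => Q1 j + Q2 j, fun z x => ?_⟩
    simp only [map_add, mul_add, Finset.sum_add_distrib, h1, h2]
    ring
  | mul_X p i hp =>
    obtain ⟨Q1, h1⟩ := hp
    refine ⟨fun j => Q1 j * X (Sum.inl i) + if j = i then rename Sum.inr p else 0,
      fun z x => ?_⟩
    have e : ∀ j, (z j - x j) * eval (Sum.elim z x) (Q1 j * X (Sum.inl i)
        + if j = i then rename Sum.inr p else 0)
        = (z j - x j) * eval (Sum.elim z x) (Q1 j) * z i
          + if j = i then (z i - x i) * eval x p else 0 := by
      intro j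
      by_cases hj : j = i
      · subst hj
        have : (Sum.elim z x ∘ Sum.inr) = x := by ext; simp
        simp [eval_rename, this]
        ring
      · simp [hj]; ring
    simp only [e, Finset.sum_add_distrib, ← Finset.sum_mul, h1]
    simp
    ring

lemma analytic_eval {n : ℕ} {σ : Type*} {g : CE n → σ → ℂ} {z : CE n}
    (hg : ∀ i, AnalyticAt ℂ (fun z => g z i) z) (P : MvPolynomial σ ℂ) :
    AnalyticAt ℂ (fun z => eval (g z) P) z := by
  induction P using MvPolynomial.induction_on with
  | C a => simpa using analyticAt_const
  | add p q hp hq => simp only [map_add]; exact hp.add hq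
  | mul_X p i hp => simp only [map_mul, eval_X]; exact hp.mul (hg i)

lemma continuous_eval' {Y : Type*} [TopologicalSpace Y] {σ : Type*} {g : Y → σ → ℂ}
    (hg : ∀ i, Continuous (fun z => g z i)) (P : MvPolynomial σ ℂ) :
    Continuous (fun z => eval (g z) P) := by
  induction P using MvPolynomial.induction_on with
  | C a => simpa using continuous_const
  | add p q hp hq => simp only [map_add]; exact hp.add hq
  | mul_X p i hp => simp only [map_mul, eval_X]; exact hp.mul (hg i)

lemma supp_mul {n : ℕ} {φ g : CE n → ℂ} {V : Set (CE n)} (hφ : ContDiff ℝ ∞ φ)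
    (hs : tsupport φ ⊆ V) (ha : AnalyticOnNhd ℂ g V) :
    ContDiff ℝ ∞ (fun z => φ z * g z) ∧
      ∀ k z, db k (fun z => φ z * g z) z = db k φ z * g z := by
  constructor
  · rw [contDiff_iff_contDiffAt]
    intro z
    by_cases hz : z ∈ tsupport φ
    · exact hφ.contDiffAt.mul (((ha z (hs hz)).contDiffAt).restrict_scalars ℝ)
    · have : (fun z => φ z * g z) =ᶠ[𝓝 z] fun _ => 0 := by
        filter_upwards [(isClosed_tsupport φ).isOpen_compl.mem_nhds hz] with y hy
        rw [image_eq_zero_of_notMem_tsupport hy, zero_mul]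
      exact contDiffAt_const.congr_of_eventuallyEq this
  · intro k z
    by_cases hz : z ∈ tsupport φ
    · have hd := (ha z (hs hz)).differentiableAt
      rw [db_mul (hφ.differentiable (by simp) z) (hd.restrictScalars ℝ), db_holo hd]
      simp
    · have h0 : φ =ᶠ[𝓝 z] fun _ => 0 := by
        filter_upwards [(isClosed_tsupport φ).isOpen_compl.mem_nhds hz] with y hy
        rw [image_eq_zero_of_notMem_tsupport hy]
      have : (fun z => φ z * g z) =ᶠ[𝓝 z] fun _ => 0 := by
        filter_upwards [h0] with y hy
        rw [hy, zero_mul]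
      rw [db_congr this, db_congr h0, db_const]; simp

/-- Polynomials as continuous functions on `K`. -/
noncomputable def polyC {n : ℕ} (K : Set (CE n)) : MvPolynomial (Fin n) ℂ →ₐ[ℂ] C(K, ℂ) :=
  aeval fun i => ⟨fun x : K => x.1 i, (continuous_apply i).comp continuous_subtype_val⟩

lemma polyC_apply {n : ℕ} (K : Set (CE n)) (p : MvPolynomial (Fin n) ℂ) (x : K) :
    polyC K p x = eval x.1 p := by
  induction p using MvPolynomial.induction_on with
  | C a => simp [polyC]
  | add p q hp hq => simp [hp, hq]
  | mul_X p i hp => simp [hp]; left; simp [polyC]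

/-- The uniform closure of polynomials. -/
noncomputable def polyA {n : ℕ} (K : Set (CE n)) [CompactSpace K] : Subalgebra ℂ C(K, ℂ) :=
  (polyC K).range.topologicalClosure

lemma polyC_mem {n : ℕ} (K : Set (CE n)) [CompactSpace K] (p : MvPolynomial (Fin n) ℂ) :
    polyC K p ∈ polyA K :=
  Subalgebra.le_topologicalClosure _ ⟨p, rfl⟩

lemma polyA_closed {n : ℕ} (K : Set (CE n)) [CompactSpace K] :
    IsClosed (polyA K : Set C(K, ℂ)) := Subalgebra.isClosed_topologicalClosure _

lemma inv_mem {n : ℕ} (K : Set (CE n)) [CompactSpace K] (p : MvPolynomial (Fin n) ℂ) (a : ℂ)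
    (M : ℝ) (hM : ∀ x ∈ K, ‖eval x p‖ ≤ M) (ha : M < ‖a‖) (hM0 : 0 ≤ M) :
    ∃ h ∈ polyA K, ∀ x : K, h x = (a - eval x.1 p)⁻¹ := by
  have ha0 : a ≠ 0 := norm_pos_iff.1 (hM0.trans_lt ha)
  set b : C(K, ℂ) := a⁻¹ • polyC K p with hb
  have hbA : b ∈ polyA K := Subalgebra.smul_mem _ (polyC_mem K p) _
  have hbn : ‖b‖ < 1 := by
    rw [hb, norm_smul, norm_inv]
    have : ‖polyC K p‖ ≤ M := by
      rw [ContinuousMap.norm_le _ hM0]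
      intro x; rw [polyC_apply]; exact hM _ x.2
    rw [inv_mul_lt_iff₀ (norm_pos_iff.2 ha0)]
    linarith
  have hg := mul_neg_geom_series b hbn
  have hsum : (∑' i, b ^ i) ∈ polyA K := by
    have hs := (summable_geometric_of_norm_lt_one hbn).hasSum
    refine (polyA_closed K).mem_of_tendsto hs (Eventually.of_forall fun S => ?_)
    exact Subalgebra.sum_mem _ fun i _ => Subalgebra.pow_mem _ hbA i
  refine ⟨a⁻¹ • ∑' i, b ^ i, Subalgebra.smul_mem _ hsum _, fun x => ?_⟩
  have := congrArg (fun h : C(K, ℂ) => h x) hg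
  simp only [ContinuousMap.mul_apply, ContinuousMap.sub_apply, ContinuousMap.one_apply, hb,
    ContinuousMap.smul_apply, polyC_apply, smul_eq_mul] at this
  rw [ContinuousMap.smul_apply, smul_eq_mul]
  rw [← hb] at this
  have h2 : (a - eval x.1 p) * (a⁻¹ * (∑' i, b ^ i) x) = 1 := by
    rw [← this]; field_simp
  exact eq_inv_of_mul_eq_one_right h2

lemma integral_mem_polyA {n : ℕ} (K : Set (CE n)) [CompactSpace K] {g : CE n → C(K, ℂ)}
    (hg : Integrable g) (h : ∀ z, g z ∈ polyA K) : ∫ z, g z ∈ polyA K := by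
  have : IsClosed ((polyA K).toSubmodule : Set C(K, ℂ)) := polyA_closed K
  have e := (Submodule.mkQL (polyA K).toSubmodule).integral_comp_comm hg
  have h0 : ∀ z, (Submodule.mkQL (polyA K).toSubmodule) (g z) = 0 := fun z =>
    (Submodule.Quotient.mk_eq_zero _).2 (h z)
  simp only [h0, integral_zero] at e
  exact (Submodule.Quotient.mk_eq_zero _).1 e.symm

open scoped Manifold in
lemma cutoff {n : ℕ} {K : Set (CE n)} (hK : IsCompact K) (hne : K.Nonempty) {f : CE n → ℂ}
    {U : Set (CE n)} (hU : IsOpen U) (hKU : K ⊆ U) (hf : AnalyticOnNhd ℂ f U) :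
    ∃ d : ℝ, 0 < d ∧ ∃ F : CE n → ℂ, ContDiff ℝ ∞ F ∧ HasCompactSupport F ∧
      (∀ z, Metric.infDist z K < 2 * d → DifferentiableAt ℂ F z) ∧
      (∀ z ∉ {z | d < Metric.infDist z K ∧ Metric.infDist z K < 4 * d}, ∀ k, db k F z = 0) ∧
      (∀ x ∈ K, F x = f x) ∧
      IsCompact {z | d ≤ Metric.infDist z K ∧ Metric.infDist z K ≤ 4 * d} := by
  obtain ⟨δ, hδ, hsub⟩ := hK.exists_cthickening_subset_open hU hKU
  set d := δ / 4 with hd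
  have hd0 : 0 < d := by positivity
  have hδd : δ = 4 * d := by rw [hd]; ring
  rw [hδd] at hsub
  have hcth : ∀ z, Metric.infDist z K ≤ 4 * d → z ∈ Metric.cthickening (4 * d) K := by
    intro z hz
    obtain ⟨y, hy, hy2⟩ := hK.exists_infDist_eq_dist hne z
    exact Metric.mem_cthickening_of_dist_le z y _ _ hy (by rw [← hy2]; exact hz)
  have hUz : ∀ z, Metric.infDist z K ≤ 4 * d → z ∈ U := fun z hz => hsub (hcth z hz)
  have hcont : Continuous (fun z => Metric.infDist z K) := Metric.continuous_infDist_pt K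
  have hcomp : ∀ c, c ≤ 4 * d → IsCompact {z | Metric.infDist z K ≤ c} := by
    intro c hc
    exact hK.cthickening.of_isClosed_subset (isClosed_le hcont continuous_const)
      fun z hz => hcth z (le_trans hz hc)
  obtain ⟨χ, h0, h1, -⟩ := exists_contMDiffMap_zero_one_of_isClosed (n := ⊤) 𝓘(ℝ, CE n)
    (s := {z | 3 * d ≤ Metric.infDist z K}) (t := {z | Metric.infDist z K ≤ 2 * d})
    (isClosed_le continuous_const hcont) (isClosed_le hcont continuous_const)
    (by
      rw [Set.disjoint_left]
      intro z hz hz'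
      simp only [mem_ofPred_eq] at hz hz'
      linarith)
  have hχ : ContDiff ℝ ∞ χ := χ.contMDiff.contDiff
  have hχC : ContDiff ℝ ∞ (fun z => ((χ z : ℝ) : ℂ)) := Complex.ofRealCLM.contDiff.comp hχ
  have hzero : ∀ z, 3 * d ≤ Metric.infDist z K → ((χ z : ℝ) : ℂ) * f z = 0 := by
    intro z hz
    have : χ z = 0 := h0 hz
    rw [this]; simp
  have hev0 : ∀ z, 3 * d < Metric.infDist z K →
      (fun z => ((χ z : ℝ) : ℂ) * f z) =ᶠ[𝓝 z] fun _ => 0 := by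
    intro z hz
    filter_upwards [(isOpen_lt continuous_const hcont).mem_nhds hz] with y hy
    exact hzero y (le_of_lt hy)
  have hev1 : ∀ z, Metric.infDist z K < 2 * d →
      (fun z => ((χ z : ℝ) : ℂ) * f z) =ᶠ[𝓝 z] f := by
    intro z hz
    filter_upwards [(isOpen_lt hcont continuous_const).mem_nhds hz] with y hy
    have : χ y = 1 := h1 (le_of_lt hy)
    rw [this]; simp
  have hdiff : ∀ z, Metric.infDist z K < 2 * d →
      DifferentiableAt ℂ (fun z => ((χ z : ℝ) : ℂ) * f z) z := fun z hz =>
    (hf z (hUz z (by linarith))).differentiableAt.congr_of_eventuallyEq (hev1 z hz)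
  refine ⟨d, hd0, fun z => ((χ z : ℝ) : ℂ) * f z, ?_, ?_, hdiff, ?_, ?_, ?_⟩
  · rw [contDiff_iff_contDiffAt]
    intro z
    by_cases hz : Metric.infDist z K ≤ 4 * d
    · exact hχC.contDiffAt.mul (((hf z (hUz z hz)).contDiffAt).restrict_scalars ℝ)
    · exact contDiffAt_const.congr_of_eventuallyEq (hev0 z (by push Not at hz; linarith))
  · refine HasCompactSupport.intro (hcomp (3 * d) (by linarith)) fun z hz => ?_
    simp only [mem_ofPred_eq, not_le] at hz
    exact hzero z hz.le
  · intro z hz k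
    by_cases h : Metric.infDist z K < 2 * d
    · exact db_holo (hdiff z h)
    · rw [db_congr (hev0 z ?_), db_const]
      by_contra h3
      exact hz ⟨by linarith, by linarith⟩
  · intro x hx
    have := (hev1 x (by rw [Metric.infDist_zero_of_mem hx]; positivity)).self_of_nhds
    exact this
  · exact (hcomp (4 * d) le_rfl).of_isClosed_subset
      ((isClosed_le continuous_const hcont).inter (isClosed_le hcont continuous_const))
      fun z hz => hz.2

open scoped Manifold in
lemma exists_pou {n : ℕ} {K L : Set (CE n)} (hK : IsCompact K) (hne : K.Nonempty)
    (hpc : K = {z | ∀ p : MvPolynomial (Fin n) ℂ,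
      ‖eval z p‖ ≤ sSup ((fun w => ‖eval w p‖) '' K)})
    (hL : IsCompact L) (hdis : ∀ z ∈ L, z ∉ K) :
    ∃ (ι : Type) (_ : Fintype ι) (P : ι → MvPolynomial (Fin n) ℂ) (M : ι → ℝ)
      (φ : ι → CE n → ℂ), (∀ i, 0 ≤ M i) ∧ (∀ i, ∀ x ∈ K, ‖eval x (P i)‖ ≤ M i) ∧
      (∀ i, ContDiff ℝ ∞ (φ i)) ∧ (∀ i, tsupport (φ i) ⊆ {z | M i < ‖eval z (P i)‖}) ∧
      ∀ z ∈ L, ∑ i, φ i z = 1 := by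
  have hcP : ∀ p : MvPolynomial (Fin n) ℂ, Continuous fun z : CE n => ‖eval z p‖ := fun p =>
    (continuous_eval' (g := fun z : CE n => z) (fun i => continuous_apply i) p).norm
  have hbd : ∀ p : MvPolynomial (Fin n) ℂ, ∀ x ∈ K,
      ‖eval x p‖ ≤ sSup ((fun w => ‖eval w p‖) '' K) := by
    intro p x hx
    exact le_csSup (hK.bddAbove_image (hcP p).continuousOn) (mem_image_of_mem _ hx)
  have hex : ∀ z : L, ∃ p : MvPolynomial (Fin n) ℂ,
      sSup ((fun w => ‖eval w p‖) '' K) < ‖eval z.1 p‖ := by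
    intro z
    by_contra! h
    apply hdis z.1 z.2
    rw [hpc]
    exact h
  choose p hp using hex
  set m : L → ℝ := fun i => sSup ((fun w => ‖eval w (p i)‖) '' K) with hm
  have hV : ∀ i : L, IsOpen {z : CE n | m i < ‖eval z (p i)‖} := fun i =>
    isOpen_lt continuous_const (hcP (p i))
  obtain ⟨t, ht⟩ := hL.elim_finite_subcover (fun i : L => {z : CE n | m i < ‖eval z (p i)‖}) hV
    (fun z hz => mem_iUnion.2 ⟨⟨z, hz⟩, hp ⟨z, hz⟩⟩)
  have ht' : L ⊆ ⋃ i : Fin t.card, {z : CE n | m (t.equivFin.symm i).1 <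
      ‖eval z (p (t.equivFin.symm i).1)‖} := by
    intro z hz
    obtain ⟨i, hi, hz2⟩ := mem_iUnion₂.1 (ht hz)
    refine mem_iUnion.2 ⟨t.equivFin ⟨i, hi⟩, ?_⟩
    simpa using hz2
  obtain ⟨φ, hφ⟩ := SmoothPartitionOfUnity.exists_isSubordinate 𝓘(ℝ, CE n) hL.isClosed _
    (fun i => hV _) ht'
  refine ⟨Fin t.card, inferInstance, fun i => p (t.equivFin.symm i).1,
    fun i => m (t.equivFin.symm i).1, fun i z => ((φ i z : ℝ) : ℂ), ?_, ?_, ?_, ?_, ?_⟩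
  · intro i
    obtain ⟨x, hx⟩ := hne
    exact (norm_nonneg _).trans (hbd _ x hx)
  · intro i x hx
    exact hbd _ x hx
  · intro i
    exact Complex.ofRealCLM.contDiff.comp (φ i).contMDiff.contDiff
  · intro i
    refine subset_trans (closure_mono ?_) (hφ i)
    intro z hz
    simpa using hz
  · intro z hz
    have := φ.sum_eq_one hz
    rw [finsum_eq_sum_of_fintype] at this
    rw [← Complex.ofReal_sum, this]; simp

lemma eval_elim_mem {n : ℕ} (K : Set (CE n)) [CompactSpace K] (z : CE n)
    (q : MvPolynomial (Fin n ⊕ Fin n) ℂ) :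
    ∃ h ∈ polyA K, ∀ x : K, h x = eval (Sum.elim z x.1) q := by
  induction q using MvPolynomial.induction_on with
  | C a =>
    refine ⟨polyC K (C a), polyC_mem K _, fun x => ?_⟩
    rw [polyC_apply]; simp
  | add p q hp hq =>
    obtain ⟨h1, m1, e1⟩ := hp
    obtain ⟨h2, m2, e2⟩ := hq
    exact ⟨h1 + h2, Subalgebra.add_mem _ m1 m2, fun x => by simp [e1, e2]⟩
  | mul_X p i hp =>
    obtain ⟨h1, m1, e1⟩ := hp
    rcases i with i | i
    · exact ⟨z i • h1, Subalgebra.smul_mem _ m1 _, fun x => by simp [e1, mul_comm]⟩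
    · exact ⟨h1 * polyC K (X i), Subalgebra.mul_mem _ m1 (polyC_mem K _), fun x => by
        simp [e1, polyC_apply]⟩

lemma det_mem {R : Type*} [CommRing R] [Algebra ℂ R] (A : Subalgebra ℂ R) {n : ℕ}
    (M : Matrix (Fin n) (Fin n) R) (h : ∀ j k, M j k ∈ A) : M.det ∈ A := by
  rw [Matrix.det_apply']
  refine Subalgebra.sum_mem _ fun σ _ => Subalgebra.mul_mem _ ?_ (Subalgebra.prod_mem _ fun i _ => h _ _)
  exact intCast_mem A _

lemma kernel {n : ℕ} {K L : Set (CE n)} [CompactSpace K]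
    {ι : Type} [Fintype ι] (P : ι → MvPolynomial (Fin n) ℂ) (M : ι → ℝ)
    (φ : ι → CE n → ℂ) (hM0 : ∀ i, 0 ≤ M i) (hM : ∀ i, ∀ x ∈ K, ‖eval x (P i)‖ ≤ M i)
    (hφ : ∀ i, ContDiff ℝ ∞ (φ i)) (hsub : ∀ i, tsupport (φ i) ⊆ {z | M i < ‖eval z (P i)‖})
    (hsum : ∀ z ∈ L, ∑ i, φ i z = 1) {F : CE n → ℂ} (hF : Continuous F)
    (hFc : HasCompactSupport F) :
    ∃ s : CE n → Fin n → CE n → ℂ, (∀ x ∈ K, ∀ j, ContDiff ℝ ∞ (s x j)) ∧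
      (∀ x ∈ K, ∀ z ∈ L, ∑ j, (z j - x j) * s x j z = 1) ∧
      ∃ h ∈ polyA K, ∀ x : K, h x = ∫ z, F z * (dbM (s x.1) z).det := by
  choose Q hQ using fun i => hefer (P i)
  set V : ι → Set (CE n) := fun i => {z | M i < ‖eval z (P i)‖} with hVdef
  have hne : ∀ i, ∀ z ∈ V i, ∀ x ∈ K, eval z (P i) - eval x (P i) ≠ 0 := by
    intro i z hz x hx h
    rw [sub_eq_zero] at h
    have h1 := hM i x hx
    rw [← h] at h1
    exact absurd hz (not_lt.2 h1)
  set u : ι → Fin n → CE n → CE n → ℂ := fun i j x z =>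
    eval (Sum.elim z x) (Q i j) * (eval z (P i) - eval x (P i))⁻¹ with hu
  have han : ∀ i j, ∀ x ∈ K, AnalyticOnNhd ℂ (u i j x) (V i) := by
    intro i j x hx z hz
    have hc : ∀ i, AnalyticAt ℂ (fun z : CE n => z i) z := fun i =>
      (ContinuousLinearMap.proj (R := ℂ) (φ := fun _ : Fin n => ℂ) i).analyticAt z
    have h1 : AnalyticAt ℂ (fun z : CE n => eval (Sum.elim z x) (Q i j)) z := by
      refine analytic_eval (g := fun z => Sum.elim z x) (fun l => ?_) _
      rcases l with l | l
      · exact hc l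
      · exact analyticAt_const
    have h2 : AnalyticAt ℂ (fun z : CE n => eval z (P i)) z :=
      analytic_eval (g := fun z => z) hc _
    exact h1.mul ((h2.sub analyticAt_const).inv (hne i z hz x hx))
  have hsm := fun i j x hx => supp_mul (hφ i) (hsub i) (han i j x hx)
  have hdb : ∀ x ∈ K, ∀ j k z, db k (fun z => ∑ i, φ i z * u i j x z) z
      = ∑ i, db k (φ i) z * u i j x z := by
    intro x hx j k z
    rw [db_sum _ (fun i _ => ((hsm i j x hx).1.differentiable (by simp) z))]
    exact Finset.sum_congr rfl fun i _ => (hsm i j x hx).2 k z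
  have hdb0 : ∀ i k, ∀ z ∉ tsupport (φ i), db k (φ i) z = 0 := by
    intro i k z hz
    have h0 : φ i =ᶠ[𝓝 z] fun _ => 0 := by
      filter_upwards [(isClosed_tsupport (φ i)).isOpen_compl.mem_nhds hz] with y hy
      rw [image_eq_zero_of_notMem_tsupport hy]
    rw [db_congr h0, db_const]
  have hcont : ∀ i j k, Continuous (fun q : CE n × K => db k (φ i) q.1 * u i j q.2.1 q.1) := by
    intro i j k
    rw [continuous_iff_continuousAt]
    rintro ⟨z, x⟩
    by_cases hz : z ∈ tsupport (φ i)
    · have c1 : Continuous (fun q : CE n × K => db k (φ i) q.1) :=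
        (db_contDiff (hφ i)).continuous.comp continuous_fst
      have cz : ∀ l, Continuous (fun q : CE n × K => q.1 l) := fun l =>
        (continuous_apply l).comp continuous_fst
      have cx : ∀ l, Continuous (fun q : CE n × K => q.2.1 l) := fun l =>
        (continuous_apply l).comp (continuous_subtype_val.comp continuous_snd)
      have c2 : Continuous (fun q : CE n × K => eval (Sum.elim q.1 q.2.1) (Q i j)) := by
        refine continuous_eval' (g := fun q : CE n × K => Sum.elim q.1 q.2.1) (fun l => ?_) _
        rcases l with l | l
        · exact cz l
        · exact cx l
      have c3 : Continuous (fun q : CE n × K => eval q.1 (P i) - eval q.2.1 (P i)) :=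
        (continuous_eval' (g := fun q : CE n × K => q.1) cz _).sub
          (continuous_eval' (g := fun q : CE n × K => q.2.1) cx _)
      exact c1.continuousAt.mul (c2.continuousAt.mul
        (c3.continuousAt.inv₀ (hne i z (hsub i hz) x.1 x.2)))
    · have : (fun q : CE n × K => db k (φ i) q.1 * u i j q.2.1 q.1) =ᶠ[𝓝 (z, x)] fun _ => 0 := by
        have : ∀ᶠ q : CE n × K in 𝓝 (z, x), q.1 ∈ (tsupport (φ i))ᶜ :=
          continuous_fst.continuousAt ((isClosed_tsupport (φ i)).isOpen_compl.mem_nhds hz)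
        filter_upwards [this] with q hq
        rw [hdb0 i k _ hq, zero_mul]
      exact continuousAt_const.congr this.symm
  set E : Fin n → Fin n → C(CE n, C(K, ℂ)) := fun j k =>
    ContinuousMap.curry ⟨fun q : CE n × K => ∑ i, db k (φ i) q.1 * u i j q.2.1 q.1,
      continuous_finsetSum _ fun i _ => hcont i j k⟩ with hE
  have hEa : ∀ j k z (x : K), E j k z x = ∑ i, db k (φ i) z * u i j x.1 z := fun _ _ _ _ => rfl
  have hEm : ∀ j k z, E j k z ∈ polyA K := by
    intro j k z
    have : ∀ i, ∃ h ∈ polyA K, ∀ x : K, h x = db k (φ i) z * u i j x.1 z := by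
      intro i
      by_cases hz : z ∈ tsupport (φ i)
      · obtain ⟨h1, m1, e1⟩ := eval_elim_mem K z (Q i j)
        obtain ⟨h2, m2, e2⟩ := inv_mem K (P i) (eval z (P i)) (M i) (hM i) (hsub i hz) (hM0 i)
        exact ⟨db k (φ i) z • (h1 * h2), Subalgebra.smul_mem _ (Subalgebra.mul_mem _ m1 m2) _,
          fun x => by simp [e1, e2, hu]⟩
      · exact ⟨0, Subalgebra.zero_mem _, fun x => by simp [hdb0 i k z hz]⟩
    choose h hm he using this
    have : E j k z = ∑ i, h i := by
      ext x
      rw [hEa, ContinuousMap.sum_apply]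
      exact Finset.sum_congr rfl fun i _ => (he i x).symm
    rw [this]
    exact Subalgebra.sum_mem _ fun i _ => hm i
  set g : CE n → C(K, ℂ) := fun z => F z • (Matrix.of fun j k => E j k z).det with hg
  have hgc : Continuous g := by
    refine hF.smul (Continuous.matrix_det ?_)
    exact continuous_matrix fun j k => (E j k).continuous
  have hgs : HasCompactSupport g := hFc.smul_right
  have hgi : Integrable g := hgc.integrable_of_hasCompactSupport hgs
  refine ⟨fun x j z => ∑ i, φ i z * u i j x z, ?_, ?_, ∫ z, g z, ?_, ?_⟩
  · intro x hx j
    exact ContDiff.sum fun i _ => (hsm i j x hx).1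
  · intro x hx z hz
    have : ∀ i, φ i z * ∑ j, (z j - x j) * u i j x z = φ i z := by
      intro i
      by_cases hz : z ∈ tsupport (φ i)
      · simp only [hu, ← mul_assoc]
        rw [← Finset.sum_mul, hQ, mul_inv_cancel₀ (hne i z (hsub i hz) x hx), mul_one]
      · rw [image_eq_zero_of_notMem_tsupport hz, zero_mul]
    rw [← hsum z hz]
    simp only [Finset.mul_sum]
    rw [Finset.sum_comm]
    refine Finset.sum_congr rfl fun i _ => ?_
    conv_rhs => rw [← this i, Finset.mul_sum]
    exact Finset.sum_congr rfl fun j _ => by ring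
  · refine integral_mem_polyA K hgi fun z => Subalgebra.smul_mem _ (det_mem _ _ fun j k => ?_) _
    exact hEm j k z
  · intro x
    have := (ContinuousMap.evalCLM ℂ x).integral_comp_comm hgi
    rw [ContinuousMap.evalCLM_apply] at this
    rw [← this]
    refine integral_congr_ae (Eventually.of_forall fun z => ?_)
    simp only [ContinuousMap.evalCLM_apply, hg, ContinuousMap.smul_apply, smul_eq_mul]
    congr 1
    have h2 := (ContinuousMap.evalAlgHom ℂ ℂ x).toRingHom.map_det (Matrix.of fun j k => E j k z)
    refine h2.trans ?_
    congr 1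
    ext j k
    exact (hEa j k z x).trans (hdb x.1 x.2 j k z).symm

lemma norm_sq_le_nsq {n : ℕ} (w : CE n) : ‖w‖ ^ 2 ≤ nsq w := by
  have h0 : 0 ≤ nsq w := by unfold nsq; positivity
  have : ‖w‖ ≤ Real.sqrt (nsq w) := by
    rw [pi_norm_le_iff_of_nonneg (Real.sqrt_nonneg _)]
    exact fun j => Real.le_sqrt_of_sq_le (le_nsq w j)
  calc ‖w‖ ^ 2 ≤ Real.sqrt (nsq w) ^ 2 := by gcongr
    _ = nsq w := Real.sq_sqrt h0

lemma nsq_smul {n : ℕ} (c : ℂ) (hc : ‖c‖ = 1) (w : CE n) : nsq (c • w) = nsq w := by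
  simp [nsq, hc]

lemma main {n : ℕ} (hn : n ≠ 0) {K : Set (CE n)} (hK : IsCompact K) (hne : K.Nonempty)
    (hpc : K = {z | ∀ p : MvPolynomial (Fin n) ℂ,
      ‖eval z p‖ ≤ sSup ((fun w => ‖eval w p‖) '' K)})
    {f : CE n → ℂ} {U : Set (CE n)} (hU : IsOpen U) (hKU : K ⊆ U)
    (hf : AnalyticOnNhd ℂ f U) {ε : ℝ} (hε : 0 < ε) :
    ∃ p : MvPolynomial (Fin n) ℂ, ∀ z ∈ K, ‖f z - eval z p‖ < ε := by
  haveI : CompactSpace K := isCompact_iff_compactSpace.1 hK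
  obtain ⟨d, hd, F, hF, hFc, hFd, hFW, hFf, hL⟩ := cutoff hK hne hU hKU hf
  obtain ⟨ι, _, P, M, φ, hM0, hM, hφ, hsub, hsum⟩ := exists_pou hK hne hpc hL (by
    intro z hz hzK
    have := hz.1
    rw [Metric.infDist_zero_of_mem hzK] at this
    linarith)
  obtain ⟨s, hs, hs1, h, hh, hhx⟩ := kernel P M φ hM0 hM hφ hsub hsum hF.continuous hFc
  obtain ⟨η, hη, hη1, hη0, hη0', hηδ, t0, ht0, hηt, hηt'⟩ := exists_eta (δ := d ^ 2) (by positivity)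
  have hrc : Continuous (rho n η) := by
    have c1 : Continuous η := hη.continuous
    have c2 : Continuous (deriv η) := hη.continuous_deriv (by simp)
    have c3 : Continuous (nsq : CE n → ℝ) := nsq_contDiff.continuous
    unfold rho
    fun_prop
  have hr0 : ∀ w : CE n, d < ‖w‖ → rho n η w = 0 := by
    intro w hw
    have : d ^ 2 ≤ nsq w := le_trans (by gcongr) (norm_sq_le_nsq w)
    unfold rho
    rw [hηδ _ this, mul_zero]
  have hrs : HasCompactSupport (rho n η) :=
    HasCompactSupport.intro (isCompact_closedBall 0 d) fun w hw => hr0 w (by simpa using hw)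
  have hpos : 0 < ∫ w, rho n η w := by
    obtain ⟨i⟩ : Nonempty (Fin n) := ⟨⟨0, Nat.pos_of_ne_zero hn⟩⟩
    refine hrc.integral_pos_of_hasCompactSupport_nonneg_nonzero hrs ?_
      (x := Pi.single i ((Real.sqrt t0 : ℝ) : ℂ)) ?_
    · intro w
      exact mul_nonneg (pow_nonneg (hη0 _) _) (hη0' _)
    · have : nsq (Pi.single i ((Real.sqrt t0 : ℝ) : ℂ) : CE n) = t0 := by
        unfold nsq
        rw [Finset.sum_eq_single i]
        · simp [Real.sq_sqrt ht0.le]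
        · intro j _ hj
          simp [hj]
        · simp
      unfold rho
      rw [this]
      positivity
  set c : ℝ := ∫ w, rho n η w with hc
  have key : ∀ x : K, h x = f x.1 * (c : ℂ) := by
    intro x
    have hWo : IsOpen {z : CE n | d < Metric.infDist z K ∧ Metric.infDist z K < 4 * d} :=
      (isOpen_lt continuous_const (Metric.continuous_infDist_pt K)).inter
        (isOpen_lt (Metric.continuous_infDist_pt K) continuous_const)
    rw [hhx, integral_det_eq (x := x.1) hF hFc (hs x.1 x.2) (fun j => srad_contDiff hη x.1 j) hWo
      hFW (fun z hz => hs1 x.1 x.2 z ⟨hz.1.le, hz.2.le⟩) (fun z hz => ?_)]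
    · simp only [srad_det hn hη]
      rw [integral_mean (F := F) (ρ := fun w => ((rho n η w : ℝ) : ℂ)) (x := x.1)
        (by linarith : d < 2 * d) hF.continuous ?_ (Complex.continuous_ofReal.comp hrc) ?_ ?_]
      · rw [integral_complex_ofReal, hFf x.1 x.2]
      · intro z hz
        exact hFd z (lt_of_le_of_lt (Metric.infDist_le_dist_of_mem x.2) hz)
      · intro w hw
        simp [hr0 w hw]
      · intro a ha w
        simp only [rho, nsq_smul a ha]
    · have : d ^ 2 ≤ nsq (z - x.1) := by
        refine le_trans ?_ (norm_sq_le_nsq _)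
        have : d ≤ ‖z - x.1‖ := by
          rw [← dist_eq_norm]
          exact hz.1.le.trans (Metric.infDist_le_dist_of_mem x.2)
        gcongr
      rw [srad_sum, hη1 _ this]; simp
  have hcl : ((c : ℂ)⁻¹ • h) ∈ closure ((polyC K).range : Set C(K, ℂ)) := by
    have : ((c : ℂ)⁻¹ • h) ∈ polyA K := Subalgebra.smul_mem _ hh _
    exact this
  obtain ⟨_, ⟨p, rfl⟩, hp⟩ := Metric.mem_closure_iff.1 hcl ε hε
  refine ⟨p, fun z hz => ?_⟩
  have h1 := (ContinuousMap.dist_apply_le_dist (f := (c : ℂ)⁻¹ • h) (g := polyC K p)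
    ⟨z, hz⟩).trans_lt hp
  rw [dist_eq_norm, ContinuousMap.smul_apply, key, polyC_apply, smul_eq_mul] at h1
  have hc0 : (c : ℂ) ≠ 0 := by exact_mod_cast hpos.ne'
  have e : (c : ℂ)⁻¹ * (f z * c) = f z := by field_simp
  rw [e] at h1
  exact h1
end OkaWeilProof
/-- Oka–Weil, Theorem 2.5. A function holomorphic in a neighborhood of a
polynomially convex compact set `K ⊆ ℂ^n` can be approximated uniformly on `K` by
polynomials. -/
theorem oka_weil (n : ℕ) (K : Set (CE n)) (hK : IsCompact K) (hpc : PolyConvex K)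
    (f : CE n → ℂ) (U : Set (CE n)) (hU : IsOpen U) (hKU : K ⊆ U)
    (hf : AnalyticOnNhd ℂ f U) (ε : ℝ) (hε : 0 < ε) :
    ∃ p : MvPolynomial (Fin n) ℂ, ∀ z ∈ K, ‖f z - eval z p‖ < ε := by
  rcases K.eq_empty_or_nonempty with rfl | hne
  · exact ⟨0, fun z hz => absurd hz (Set.notMem_empty z)⟩
  rcases Nat.eq_zero_or_pos n with rfl | hn
  · refine ⟨C (f 0), fun z _ => ?_⟩
    rw [Subsingleton.elim z 0]
    simpa using hε
  · exact OkaWeilProof.main hn.ne' hK hne hpc hU hKU hf hε
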